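/- Let (W, S) be a Coxeter system, H ⊆ S, w ∈ W^H, and M an H-special matching of [e,w]. Define M^H : [e,w]^H → [e,w]^H by M^H(x) = M(x) if M(x) ∈ W^H, and M^H(x) = x if M(x) ∉ W^H. Then M^H is a special partial matching of the poset [e,w]^H. -/

import Mathlib

open Polynomial

section Bruhat

variable {B : Type*} {W : Type*} [Group W] {Mat : CoxeterMatrix B} (cs : CoxeterSystem Mat W)

/-- One step of the Bruhat order on a Coxeter group: multiply on the right by a
reflection and increase the length. -/
def bstep (u v : W) : Prop :=
  (∃ t : W, cs.IsReflection t ∧ v = u * t) ∧ cs.length u < cs.length v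

/-- The Bruhat order `≤` on the Coxeter group `W`. -/
def ble (u v : W) : Prop :=
  Relation.ReflTransGen (bstep cs) u v

/-- Strict Bruhat order. -/
def blt (u v : W) : Prop := ble cs u v ∧ u ≠ v

/-- Covering relation of the Bruhat order. -/
def bcov (u v : W) : Prop :=
  blt cs u v ∧ ∀ z : W, ble cs u z → ble cs z v → z = u ∨ z = v

/-- The set `W^H` of minimal coset representatives:
`w` with `ℓ(w s) > ℓ(w)` for all `s ∈ H`. -/
def WH (H : Set B) : Set W :=
  {w | ∀ i ∈ H, cs.length w < cs.length (w * cs.simple i)}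

end Bruhat

attribute [local instance] Classical.propDecidable

section Matchings

variable {B : Type*} {W : Type*} [Group W] {Mat : CoxeterMatrix B} (cs : CoxeterSystem Mat W)

/-- A special matching of the Bruhat interval `[e,w]`, encoded as a total function
`M : W → W` whose values outside `[e,w]` are irrelevant. -/
def IsSpecialMatching (w : W) (M : W → W) : Prop :=
  (∀ x, ble cs x w → ble cs (M x) w) ∧
  (∀ x, ble cs x w → M (M x) = x) ∧
  (∀ x, ble cs x w → (bcov cs (M x) x ∨ bcov cs x (M x))) ∧
  (∀ u v, ble cs u w → ble cs v w → bcov cs u v → M u ≠ v → ble cs (M u) (M v))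

/-- An `H`-special matching of `[e,w]`. -/
def IsHSpecial (H : Set B) (w : W) (M : W → W) : Prop :=
  IsSpecialMatching cs w M ∧
  ∀ u, ble cs u w → u ∈ WH cs H → bcov cs (M u) u → M u ∈ WH cs H

/-- `x` is covered by `y` inside the subposet induced by the Bruhat order on `O`. -/
def CovInB (O : Set W) (x y : W) : Prop :=
  x ∈ O ∧ y ∈ O ∧ blt cs x y ∧ ∀ z ∈ O, ¬ (blt cs x z ∧ blt cs z y)

/-- The map `M^H` obtained from an `H`-special matching `M`: `M^H x = M x` if
`M x ∈ W^H`, and `M^H x = x` otherwise. -/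
noncomputable def MHmap (H : Set B) (M : W → W) : W → W :=
  fun x => if M x ∈ WH cs H then M x else x

/-- A special partial matching of the subposet induced on the set `Q` (with top `t`):
`M` maps `Q` to itself, is an involution on `Q`, `M t` is covered by `t` in `Q`, every
element of `Q` is moved to a covered, equal or covering element of `Q`, and whenever
`x ⋖ y` in `Q` with `M x ≠ y` one has `M x < M y`. -/
def IsSPMOnSet (Q : Set W) (t : W) (M : W → W) : Prop :=
  (∀ x ∈ Q, M x ∈ Q) ∧ (∀ x ∈ Q, M (M x) = x) ∧ CovInB cs Q (M t) t ∧
  (∀ x ∈ Q, (CovInB cs Q (M x) x ∨ M x = x ∨ CovInB cs Q x (M x))) ∧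
  (∀ x ∈ Q, ∀ y ∈ Q, CovInB cs Q x y → M x ≠ y → blt cs (M x) (M y))

end Matchings

section ReflectionCocycle

variable {B : Type*} {W : Type*} [Group W] {Mat : CoxeterMatrix B} (cs : CoxeterSystem Mat W)

/-- The action of a simple reflection on signed group elements: conjugation, with a sign change
at the simple reflection itself. -/
noncomputable def signedConjSimple (i : B) : Function.End (W × ZMod 2) :=
  fun p => (cs.simple i * p.1 * cs.simple i, p.2 + if p.1 = cs.simple i then 1 else 0)

theorem signedConjSimple_mul_pow (i j : B) (n : ℕ) (t : W) (ε : ZMod 2) :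
    ((signedConjSimple cs i * signedConjSimple cs j) ^ n : Function.End (W × ZMod 2)) (t, ε) =
      ((cs.simple i * cs.simple j) ^ n * t * ((cs.simple i * cs.simple j) ^ n)⁻¹,
        ε + ∑ k ∈ Finset.range (2 * n),
          if t = cs.simple j * (cs.simple i * cs.simple j) ^ k then 1 else 0) := by
  induction n with
  | zero => simp [Function.End.one_def]
  | succ n ih =>
    have hcomm : ∀ k : ℕ, ((cs.simple i * cs.simple j) ^ k)⁻¹ * cs.simple j =
        cs.simple j * (cs.simple i * cs.simple j) ^ k := by
      intro k
      induction k with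
      | zero => simp
      | succ k ihk =>
        rw [pow_succ, mul_inv_rev, mul_assoc, ihk, ← pow_succ, pow_succ']
        simp [mul_assoc]
    rw [pow_succ']
    change (signedConjSimple cs i * signedConjSimple cs j)
      (((signedConjSimple cs i * signedConjSimple cs j) ^ n : Function.End (W × ZMod 2)) (t, ε)) = _
    rw [ih, show 2 * (n + 1) = 2 * n + 1 + 1 by ring, Finset.sum_range_succ,
      Finset.sum_range_succ]
    change signedConjSimple cs i (signedConjSimple cs j _) = _
    simp only [signedConjSimple]
    have h1 : (cs.simple i * cs.simple j) ^ n * t * ((cs.simple i * cs.simple j) ^ n)⁻¹ =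
        cs.simple j ↔ t = cs.simple j * (cs.simple i * cs.simple j) ^ (2 * n) := by
      rw [two_mul, pow_add, ← mul_assoc, ← hcomm, mul_inv_eq_iff_eq_mul, mul_assoc,
        eq_inv_mul_iff_mul_eq]
    have h2 : cs.simple j * ((cs.simple i * cs.simple j) ^ n * t *
        ((cs.simple i * cs.simple j) ^ n)⁻¹) * cs.simple j = cs.simple i ↔
        t = cs.simple j * (cs.simple i * cs.simple j) ^ (2 * n + 1) := by
      have h3 : ∀ z, cs.simple j * z * cs.simple j = cs.simple i ↔
          z = cs.simple j * (cs.simple i * cs.simple j) := fun z => by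
        constructor
        · intro h
          rw [← h]
          simp [mul_assoc]
        · rintro rfl
          simp [mul_assoc]
      rw [h3, mul_inv_eq_iff_eq_mul, show 2 * n + 1 = n + (1 + n) by ring, pow_add,
        ← mul_assoc (cs.simple j) (_ ^ n), ← hcomm, mul_assoc _⁻¹, eq_inv_mul_iff_mul_eq, pow_add, pow_one, mul_assoc (cs.simple j)]
    simp only [h1, h2, Prod.mk.injEq]
    refine ⟨?_, by ring⟩
    simp [pow_succ', mul_assoc]

theorem isLiftable_signedConjSimple : Mat.IsLiftable (signedConjSimple cs) := by
  intro i j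
  funext ⟨t, ε⟩
  rw [signedConjSimple_mul_pow, two_mul, Finset.sum_range_add]
  simp only [pow_add, cs.simple_mul_simple_pow, one_mul, CharTwo.add_self_eq_zero]
  simp [Function.End.one_def]

/-- The action of `W` on `W × ZMod 2` extending `signedConjSimple`. -/
noncomputable def signedConj : W →* Function.End (W × ZMod 2) :=
  cs.lift ⟨signedConjSimple cs, isLiftable_signedConjSimple cs⟩

/-- The reflection cocycle; on a reflection `t` it is `1` iff `t` is a right inversion of `w`. -/
noncomputable def inversionParity (w t : W) : ZMod 2 := (signedConj cs w (t, 0)).2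

theorem signedConj_simple (i : B) : signedConj cs (cs.simple i) = signedConjSimple cs i :=
  cs.lift_apply_simple _ _

theorem signedConj_apply (w t : W) (ε : ZMod 2) :
    signedConj cs w (t, ε) = (w * t * w⁻¹, ε + inversionParity cs w t) := by
  induction w using cs.simple_induction_left generalizing t ε with
  | one => simp [inversionParity, Function.End.one_def]
  | mul_simple_left w i ih =>
    have h : ∀ ε, signedConj cs (cs.simple i * w) (t, ε) =
        signedConjSimple cs i (signedConj cs w (t, ε)) := fun ε => by
      rw [map_mul, signedConj_simple]; rfl
    rw [inversionParity, h, h, ih, ih]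
    simp [signedConjSimple, mul_assoc, add_assoc]

theorem inversionParity_mul (u w t : W) : inversionParity cs (u * w) t =
    inversionParity cs w t + inversionParity cs u (w * t * w⁻¹) := by
  have h : signedConj cs (u * w) (t, 0) = signedConj cs u (signedConj cs w (t, 0)) := by
    rw [map_mul]; rfl
  rw [inversionParity, h, signedConj_apply, signedConj_apply, zero_add]

theorem inversionParity_one (t : W) : inversionParity cs 1 t = 0 := by
  simp [inversionParity, Function.End.one_def]

theorem inversionParity_simple (i : B) (t : W) :
    inversionParity cs (cs.simple i) t = if t = cs.simple i then 1 else 0 := by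
  simp [inversionParity, signedConj_simple, signedConjSimple]

theorem inversionParity_self {t : W} (ht : cs.IsReflection t) : inversionParity cs t t = 1 := by
  obtain ⟨w, i, rfl⟩ := ht
  have h := inversionParity_mul cs w w⁻¹ (w * cs.simple i * w⁻¹)
  have h' : w⁻¹ * (w * cs.simple i * w⁻¹) * w⁻¹⁻¹ = cs.simple i := by group
  rw [mul_inv_cancel, inversionParity_one, h'] at h
  rw [inversionParity_mul, inversionParity_mul, h', inversionParity_simple, if_pos rfl,
    mul_inv_cancel_right]
  linear_combination -h

theorem mem_rightInvSeq_of_inversionParity_ne_zero (ω : List B) (t : W)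
    (h : inversionParity cs (cs.wordProd ω) t ≠ 0) : t ∈ cs.rightInvSeq ω := by
  induction ω with
  | nil => simp [inversionParity_one] at h
  | cons i ω ih =>
    rw [CoxeterSystem.rightInvSeq, List.mem_cons]
    by_cases h' : inversionParity cs (cs.wordProd ω) t = 0
    · rw [cs.wordProd_cons, inversionParity_mul, h', zero_add, inversionParity_simple] at h
      left
      have := (ite_ne_right_iff.1 h).1
      rw [← this]; group
    · exact Or.inr (ih h')

theorem length_mul_lt_iff_inversionParity {t : W} (ht : cs.IsReflection t) (w : W) :
    cs.length (w * t) < cs.length w ↔ inversionParity cs w t ≠ 0 := by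
  have key : ∀ u, inversionParity cs u t ≠ 0 → cs.length (u * t) < cs.length u := by
    intro u hu
    obtain ⟨ω, hω, rfl⟩ := cs.exists_isReduced u
    exact (cs.isRightInversion_of_mem_rightInvSeq hω
      (mem_rightInvSeq_of_inversionParity_ne_zero cs ω t hu)).2
  refine ⟨fun h h0 => ?_, key w⟩
  have h1 : inversionParity cs (w * t) t ≠ 0 := by
    rw [inversionParity_mul, mul_inv_cancel_right, h0, inversionParity_self cs ht]
    decide
  have h2 := key _ h1
  rw [mul_assoc, ht.mul_self, mul_one] at h2
  omega

end ReflectionCocycle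

section BruhatLemmas

variable {B : Type*} {W : Type*} [Group W] {Mat : CoxeterMatrix B} (cs : CoxeterSystem Mat W)

theorem bstep_simple_mul {u v : W} (h : bstep cs u v) (i : B) :
    cs.simple i * u = v ∨ bstep cs (cs.simple i * u) (cs.simple i * v) := by
  obtain ⟨⟨t, ht, rfl⟩, hlt⟩ := h
  refine or_iff_not_imp_left.2 fun hne => ⟨⟨t, ht, (mul_assoc _ _ _).symm⟩, ?_⟩
  have hv : inversionParity cs (u * t) t ≠ 0 := by
    rw [← length_mul_lt_iff_inversionParity cs ht, mul_assoc, ht.mul_self, mul_one]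
    exact hlt
  have hsv : inversionParity cs (cs.simple i * (u * t)) t ≠ 0 := by
    rw [inversionParity_mul, inversionParity_simple, if_neg, add_zero]
    · exact hv
    · intro h
      apply hne
      rw [← h]
      simp [mul_assoc, ht.inv, ht.mul_self]
  rw [← length_mul_lt_iff_inversionParity cs ht] at hsv
  simpa [mul_assoc, ht.mul_self] using hsv

theorem bstep_inv {u v : W} (h : bstep cs u v) : bstep cs u⁻¹ v⁻¹ := by
  obtain ⟨⟨t, ht, rfl⟩, hlt⟩ := h
  refine ⟨⟨u * t * u⁻¹, ht.conj u, ?_⟩, by simpa only [cs.length_inv] using hlt⟩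
  rw [mul_inv_rev, ht.inv]
  group

theorem bstep_mul_simple {u v : W} (h : bstep cs u v) (i : B) :
    u * cs.simple i = v ∨ bstep cs (u * cs.simple i) (v * cs.simple i) := by
  refine (bstep_simple_mul cs (bstep_inv cs h) i).imp (fun h => ?_) (fun h => ?_)
  · simpa using congrArg (·⁻¹) h
  · simpa using bstep_inv cs h

theorem ble_refl (u : W) : ble cs u u := Relation.ReflTransGen.refl

variable {cs}

theorem bstep.ble {u v : W} (h : bstep cs u v) : ble cs u v := Relation.ReflTransGen.single h

theorem ble.trans {u v w : W} (h : ble cs u v) (h' : ble cs v w) : ble cs u w :=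
  Relation.ReflTransGen.trans h h'

theorem ble.eq_or_length_lt {u v : W} (h : ble cs u v) :
    u = v ∨ cs.length u < cs.length v := by
  induction h with
  | refl => exact Or.inl rfl
  | tail _ h ih =>
    right
    rcases ih with rfl | ih
    · exact h.2
    · exact ih.trans h.2

theorem blt.length_lt {u v : W} (h : blt cs u v) : cs.length u < cs.length v :=
  h.1.eq_or_length_lt.resolve_left h.2

theorem blt_of_ble_of_length_lt {u v : W} (h : ble cs u v) (hl : cs.length u < cs.length v) :
    blt cs u v := ⟨h, by rintro rfl; omega⟩

theorem blt_of_blt_of_ble {u v w : W} (h : blt cs u v) (h' : ble cs v w) : blt cs u w :=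
  blt_of_ble_of_length_lt (h.1.trans h') <| by
    rcases h'.eq_or_length_lt with rfl | h''
    · exact h.length_lt
    · exact h.length_lt.trans h''

theorem bcov_of_ble_of_length {u v : W} (h : ble cs u v) (hl : cs.length u + 1 = cs.length v) :
    bcov cs u v := by
  refine ⟨blt_of_ble_of_length_lt h (by omega), fun z hz hz' => ?_⟩
  rcases hz.eq_or_length_lt with rfl | h1
  · exact Or.inl rfl
  · rcases hz'.eq_or_length_lt with rfl | h2
    · exact Or.inr rfl
    · omega

theorem bcov.covInB {u v : W} {O : Set W} (h : bcov cs u v) (hu : u ∈ O) (hv : v ∈ O) :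
    CovInB cs O u v := by
  refine ⟨hu, hv, h.1, fun z _ hz => ?_⟩
  rcases h.2 z hz.1.1 hz.2.1 with h' | h'
  · exact hz.1.2 h'.symm
  · exact hz.2.2 h'

variable (cs)

theorem bstep_simple_mul_self {u : W} {i : B} (h : cs.length u < cs.length (cs.simple i * u)) :
    bstep cs u (cs.simple i * u) :=
  ⟨⟨u⁻¹ * cs.simple i * u, by simpa using (cs.isReflection_simple i).conj u⁻¹, by group⟩, h⟩

theorem bstep_mul_simple_self {u : W} {i : B} (h : cs.length u < cs.length (u * cs.simple i)) :
    bstep cs u (u * cs.simple i) :=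
  ⟨⟨cs.simple i, cs.isReflection_simple i, rfl⟩, h⟩

/-- A fixed-point-free involution of `W` satisfying the lifting property on Bruhat steps, such as
multiplication by a simple reflection on either side. -/
structure IsLifting (g : W → W) : Prop where
  invol : ∀ u, g (g u) = u
  length_ne : ∀ u, cs.length (g u) ≠ cs.length u
  step_self : ∀ u, cs.length u < cs.length (g u) → bstep cs u (g u)
  step : ∀ u v, bstep cs u v → g u = v ∨ bstep cs (g u) (g v)

theorem isLifting_simple_mul (i : B) : IsLifting cs (cs.simple i * ·) where
  invol _ := cs.simple_mul_simple_cancel_left i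
  length_ne u := cs.length_simple_mul_ne u i
  step_self _ := bstep_simple_mul_self cs
  step _ _ h := bstep_simple_mul cs h i

theorem isLifting_mul_simple (i : B) : IsLifting cs (· * cs.simple i) where
  invol _ := cs.simple_mul_simple_cancel_right i
  length_ne u := cs.length_mul_simple_ne u i
  step_self _ := bstep_mul_simple_self cs
  step _ _ h := bstep_mul_simple cs h i

/-- The shorter of `u` and `g u`. -/
noncomputable def shorter (g : W → W) (u : W) : W :=
  if cs.length (g u) < cs.length u then g u else u

/-- The longer of `u` and `g u`. -/
noncomputable def longer (g : W → W) (u : W) : W :=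
  if cs.length (g u) < cs.length u then u else g u

variable {cs}

namespace IsLifting

variable {g : W → W} {u v : W}

theorem lt_apply (hg : IsLifting cs g) (h : ¬ cs.length (g u) < cs.length u) : cs.length u < cs.length (g u) := by
  have := hg.length_ne u
  omega

theorem apply_ble (hg : IsLifting cs g) (h : cs.length (g u) < cs.length u) : ble cs (g u) u := by
  have := (hg.step_self (g u) (by rwa [hg.invol])).ble
  rwa [hg.invol] at this

theorem shorter_mono (hg : IsLifting cs g) (h : ble cs u v) : ble cs (shorter cs g u) (shorter cs g v) := by
  induction h with
  | refl => exact ble_refl cs _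
  | @tail v w _ h ih =>
    refine ih.trans ?_
    unfold shorter
    rcases hg.step _ _ h with rfl | h'
    · have h1 := h.2
      rw [hg.invol, if_neg h1.not_gt, if_pos h1]
      exact ble_refl cs _
    · split_ifs with h1 h2 h2
      · exact h'.ble
      · exact (hg.apply_ble h1).trans h.ble
      · exact ((hg.step_self _ (hg.lt_apply h1)).ble).trans h'.ble
      · exact h.ble

theorem longer_mono (hg : IsLifting cs g) (h : ble cs u v) : ble cs (longer cs g u) (longer cs g v) := by
  induction h with
  | refl => exact ble_refl cs _
  | @tail v w _ h ih =>
    refine ih.trans ?_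
    unfold longer
    rcases hg.step _ _ h with rfl | h'
    · have h1 := h.2
      rw [hg.invol, if_neg h1.not_gt, if_pos h1]
      exact ble_refl cs _
    · split_ifs with h1 h2 h2
      · exact h.ble
      · exact h.ble.trans (hg.step_self _ (hg.lt_apply h2)).ble
      · exact h'.ble.trans (hg.apply_ble h2)
      · exact h'.ble

theorem ble_apply_of_ble (hg : IsLifting cs g) (h : ble cs u v) (hu : cs.length u < cs.length (g u))
    (hv : cs.length (g v) < cs.length v) : ble cs u (g v) := by
  have := hg.shorter_mono h
  rwa [shorter, shorter, if_neg hu.not_gt, if_pos hv] at this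

theorem apply_ble_apply (hg : IsLifting cs g) (h : ble cs u v) (hu : cs.length (g u) < cs.length u)
    (hv : cs.length (g v) < cs.length v) : ble cs (g u) (g v) := by
  have := hg.shorter_mono h
  rwa [shorter, shorter, if_pos hu, if_pos hv] at this

theorem apply_ble_of_ble (hg : IsLifting cs g) (h : ble cs u v) (hu : cs.length u < cs.length (g u))
    (hv : cs.length (g v) < cs.length v) : ble cs (g u) v := by
  have := hg.longer_mono h
  rwa [longer, longer, if_neg hu.not_gt, if_pos hv] at this

theorem apply_ble_apply_of_lt (hg : IsLifting cs g) (h : ble cs u v) (hu : cs.length u < cs.length (g u))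
    (hv : cs.length v < cs.length (g v)) : ble cs (g u) (g v) := by
  have := hg.longer_mono h
  rwa [longer, longer, if_neg hu.not_gt, if_neg hv.not_gt] at this

end IsLifting

variable {H : Set B}

theorem simple_mul_mem_WH {y : W} (hy : y ∈ WH cs H) {i : B}
    (h : cs.length (cs.simple i * y) < cs.length y) : cs.simple i * y ∈ WH cs H := by
  intro r hr
  have h1 := hy r hr
  have h2 := cs.length_simple_mul (y * cs.simple r) i
  rw [mul_assoc]
  omega

theorem exists_simple_mul_eq_mul_simple {z : W} (hz : z ∈ WH cs H) {i : B}
    (hsz : cs.simple i * z ∉ WH cs H) : ∃ r ∈ H, cs.simple i * z = z * cs.simple r := by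
  simp only [WH, Set.mem_ofPred_eq, not_forall] at hsz
  obtain ⟨r, hr, h⟩ := hsz
  refine ⟨r, hr, (bstep_simple_mul cs (bstep_mul_simple_self cs (hz r hr)) i).resolve_right
    fun h' => h ?_⟩
  rw [mul_assoc]
  exact h'.2

/-- The poset `W^H` is graded by length: if `x < y` in `W^H`, then some `z ∈ W^H` of length one
less than that of `y` satisfies `x ≤ z ≤ y`. -/
theorem exists_mem_WH_length_succ {x y : W} (hx : x ∈ WH cs H) (hy : y ∈ WH cs H)
    (hxy : blt cs x y) :
    ∃ z ∈ WH cs H, ble cs x z ∧ ble cs z y ∧ cs.length z + 1 = cs.length y := by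
  induction hn : cs.length y using Nat.strong_induction_on generalizing x y with
  | _ n ih =>
  subst hn
  have hy1 : y ≠ 1 := by
    rintro rfl
    simpa using hxy.length_lt
  obtain ⟨i, hi⟩ := cs.exists_leftDescent_of_ne_one hy1
  have hs := isLifting_simple_mul cs i
  have hsyH := simple_mul_mem_WH hy hi
  have hsy := hs.apply_ble hi
  have hsyl := cs.isLeftDescent_iff.1 hi
  suffices ble cs x (cs.simple i * y) ∨
      ∃ z ∈ WH cs H, ble cs x z ∧ ble cs z y ∧ cs.length z + 1 = cs.length y by
    rcases this with h | h
    · exact ⟨_, hsyH, h, hsy, hsyl⟩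
    · exact h
  by_cases hxi : cs.length (cs.simple i * x) < cs.length x
  · have hsx : blt cs (cs.simple i * x) (cs.simple i * y) :=
      ⟨hs.apply_ble_apply hxy.1 hxi hi, fun h => hxy.2 (mul_left_cancel h)⟩
    obtain ⟨z, hzH, hxz, hzy, hzl⟩ := ih _ hi (simple_mul_mem_WH hx hxi) hsyH hsx rfl
    have hxi' : cs.length (cs.simple i * x) < cs.length (cs.simple i * (cs.simple i * x)) := by
      rwa [cs.simple_mul_simple_cancel_left]
    by_cases hzi : cs.length (cs.simple i * z) < cs.length z
    · left
      have := hs.apply_ble_of_ble hxz hxi' hzi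
      rw [cs.simple_mul_simple_cancel_left] at this
      exact this.trans hzy
    · have hzi' := hs.lt_apply hzi
      have hxsz := hs.apply_ble_apply_of_lt hxz hxi' hzi'
      rw [cs.simple_mul_simple_cancel_left] at hxsz
      by_cases hszH : cs.simple i * z ∈ WH cs H
      · exact Or.inr ⟨_, hszH, hxsz, hs.apply_ble_of_ble (hzy.trans hsy) hzi' hi,
          by have := cs.not_isLeftDescent_iff.1 hzi; omega⟩
      · left
        obtain ⟨r, hr, hzr⟩ := exists_simple_mul_eq_mul_simple hzH hszH
        rw [hzr] at hxsz
        have := (isLifting_mul_simple cs r).ble_apply_of_ble hxsz (hx r hr)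
          (by simpa using hzH r hr)
        rw [cs.simple_mul_simple_cancel_right] at this
        exact this.trans hzy
  · exact Or.inl (hs.ble_apply_of_ble hxy.1 (hs.lt_apply hxi) hi)

theorem CovInB.bcov {w x y : W} (h : CovInB cs {z : W | z ∈ WH cs H ∧ ble cs z w} x y) :
    bcov cs x y := by
  obtain ⟨hx, hy, hxy, hcov⟩ := h
  obtain ⟨z, hz, hxz, hzy, hl⟩ := exists_mem_WH_length_succ hx.1 hy.1 hxy
  have : x = z := by
    by_contra hne
    exact hcov z ⟨hz, hzy.trans hy.2⟩ ⟨⟨hxz, hne⟩, blt_of_ble_of_length_lt hzy (by omega)⟩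
  subst this
  exact bcov_of_ble_of_length hzy hl

/-- If `u ∉ W^H` covers `y ∈ W^H`, then `y` is the maximum of the elements of `W^H` below `u`. -/
theorem ble_of_bcov_of_not_mem_WH {u y z : W} (hu : u ∉ WH cs H) (hy : y ∈ WH cs H)
    (hz : z ∈ WH cs H) (hyu : bcov cs y u) (hzu : ble cs z u) : ble cs z y := by
  simp only [WH, Set.mem_ofPred_eq, not_forall] at hu
  obtain ⟨r, hr, h⟩ := hu
  have hs := isLifting_mul_simple cs r
  have hur : cs.length (u * cs.simple r) < cs.length u := by
    have := cs.length_mul_simple_ne u r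
    omega
  have hzr := hs.ble_apply_of_ble hzu (hz r hr) hur
  rcases hyu.2 _ (hs.ble_apply_of_ble hyu.1.1 (hy r hr) hur) (hs.apply_ble hur) with h' | h'
  · rwa [h'] at hzr
  · simp [h'] at hur

end BruhatLemmas

/-- Let `w ∈ W^H` and let `M` be an `H`-special matching of `[e,w]`.
Then `M^H` is a special partial matching of the poset `[e,w]^H = {z ∈ W^H : z ≤ w}`. -/
theorem stmt17 {B : Type*} {W : Type*} [Group W] {Mat : CoxeterMatrix B}
    (cs : CoxeterSystem Mat W) (H : Set B) (w : W) (hw : w ∈ WH cs H)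
    (M : W → W) (hM : IsHSpecial cs H w M) :
    IsSPMOnSet cs {z : W | z ∈ WH cs H ∧ ble cs z w} w (MHmap cs H M) := by
  obtain ⟨⟨hMw, hinv, hcov, hspec⟩, hH⟩ := hM
  have hup : ∀ x ∈ WH cs H, ble cs x w → M x ∉ WH cs H → bcov cs x (M x) := fun x hx hxw hMx =>
    (hcov x hxw).resolve_left fun h => hMx (hH x hxw hx h)
  have hmaps : ∀ x ∈ {z : W | z ∈ WH cs H ∧ ble cs z w},
      MHmap cs H M x ∈ {z : W | z ∈ WH cs H ∧ ble cs z w} := by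
    rintro x ⟨hx, hxw⟩
    unfold MHmap
    split_ifs with h
    · exact ⟨h, hMw x hxw⟩
    · exact ⟨hx, hxw⟩
  refine ⟨hmaps, ?_, ?_, ?_, ?_⟩
  · rintro x ⟨hx, hxw⟩
    by_cases h : M x ∈ WH cs H
    · simp [MHmap, h, hinv x hxw, hx]
    · simp [MHmap, h]
  · have hww := ble_refl cs w
    have hMcov : bcov cs (M w) w := (hcov w hww).resolve_right fun h => by
      have h1 := h.1.length_lt
      rcases (hMw w hww).eq_or_length_lt with h2 | h2
      · exact h.1.2 h2.symm
      · omega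
    have hMH := hH w hww hw hMcov
    rw [MHmap, if_pos hMH]
    exact hMcov.covInB ⟨hMH, hMw w hww⟩ ⟨hw, hww⟩
  · rintro x ⟨hx, hxw⟩
    by_cases h : M x ∈ WH cs H
    · rw [MHmap, if_pos h]
      rcases hcov x hxw with h' | h'
      · exact Or.inl (h'.covInB ⟨h, hMw x hxw⟩ ⟨hx, hxw⟩)
      · exact Or.inr (Or.inr (h'.covInB ⟨hx, hxw⟩ ⟨h, hMw x hxw⟩))
    · exact Or.inr (Or.inl (if_neg h))
  · rintro x ⟨hx, hxw⟩ y ⟨hy, hyw⟩ hxy hne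
    have hbc := hxy.bcov
    have hMle : M x ≠ y → ble cs (M x) (M y) := hspec x y hxw hyw hbc
    unfold MHmap at hne ⊢
    by_cases hMx : M x ∈ WH cs H <;> by_cases hMy : M y ∈ WH cs H
    · rw [if_pos hMx] at hne
      rw [if_pos hMx, if_pos hMy]
      refine ⟨hMle hne, fun h => hbc.1.2 ?_⟩
      rw [← hinv x hxw, h, hinv y hyw]
    · rw [if_pos hMx] at hne
      rw [if_pos hMx, if_neg hMy]
      exact ⟨ble_of_bcov_of_not_mem_WH hMy hy hMx (hup y hy hyw hMy) (hMle hne), hne⟩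
    · rw [if_neg hMx, if_pos hMy]
      exact blt_of_blt_of_ble (hup x hx hxw hMx).1 (hMle fun h => hMx (h ▸ hy))
    · rw [if_neg hMx, if_neg hMy]
      exact hbc.1
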